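/- Every ℝ-algebra automorphism of the quaternions is inner: if φ : ℍ → ℍ is an ℝ-algebra automorphism, then there exists a quaternion q with ‖q‖ = 1 such that φ(x) = q x q⁻¹ for all x ∈ ℍ. (Hence the automorphism group of ℍ is the 3-dimensional rotation group SO(3).) -/

import Mathlib

namespace Quaternion

/-- The imaginary unit `i` of the real quaternions. -/
def unitI : Quaternion ℝ := ⟨0, 1, 0, 0⟩

/-- The imaginary unit `j` of the real quaternions. -/
def unitJ : Quaternion ℝ := ⟨0, 0, 1, 0⟩

/-- The imaginary unit `k` of the real quaternions. -/
def unitK : Quaternion ℝ := ⟨0, 0, 0, 1⟩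

@[simp] theorem re_unitI : unitI.re = 0 := rfl
@[simp] theorem imI_unitI : unitI.imI = 1 := rfl
@[simp] theorem imJ_unitI : unitI.imJ = 0 := rfl
@[simp] theorem imK_unitI : unitI.imK = 0 := rfl

@[simp] theorem re_unitJ : unitJ.re = 0 := rfl
@[simp] theorem imI_unitJ : unitJ.imI = 0 := rfl
@[simp] theorem imJ_unitJ : unitJ.imJ = 1 := rfl
@[simp] theorem imK_unitJ : unitJ.imK = 0 := rfl

@[simp] theorem re_unitK : unitK.re = 0 := rfl
@[simp] theorem imI_unitK : unitK.imI = 0 := rfl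
@[simp] theorem imJ_unitK : unitK.imJ = 0 := rfl
@[simp] theorem imK_unitK : unitK.imK = 1 := rfl

/-- The sum of `φ e * t * e⁻¹` over the standard basis `e = 1, i, j, k` of the quaternions. -/
noncomputable def averagedIntertwiner (φ : Quaternion ℝ →ₐ[ℝ] Quaternion ℝ) (t : Quaternion ℝ) :
    Quaternion ℝ :=
  t - φ unitI * t * unitI - φ unitJ * t * unitJ -
    φ unitK * t * unitK

theorem eq_smul_basis (x : Quaternion ℝ) :
    x = x.re • (1 : Quaternion ℝ) + x.imI • unitI +
      x.imJ • unitJ + x.imK • unitK := by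
  ext <;> simp

theorem map_mul_averagedIntertwiner (φ : Quaternion ℝ →ₐ[ℝ] Quaternion ℝ) (t x : Quaternion ℝ) :
    φ x * averagedIntertwiner φ t = averagedIntertwiner φ t * x := by
  have hii : (unitI * unitI : Quaternion ℝ) = -1 := by ext <;> simp
  have hjj : (unitJ * unitJ : Quaternion ℝ) = -1 := by ext <;> simp
  have hkk : (unitK * unitK : Quaternion ℝ) = -1 := by ext <;> simp
  have hij : (unitI * unitJ : Quaternion ℝ) = unitK := by ext <;> simp
  have hji : (unitJ * unitI : Quaternion ℝ) = -unitK := by ext <;> simp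
  have hjk : (unitJ * unitK : Quaternion ℝ) = unitI := by ext <;> simp
  have hkj : (unitK * unitJ : Quaternion ℝ) = -unitI := by ext <;> simp
  have hki : (unitK * unitI : Quaternion ℝ) = unitJ := by ext <;> simp
  have hik : (unitI * unitK : Quaternion ℝ) = -unitJ := by ext <;> simp
  rw [eq_smul_basis x]
  unfold averagedIntertwiner
  generalize unitI = i at *
  generalize unitJ = j at *
  generalize unitK = k at *
  simp only [map_add, map_smul, map_one, add_mul, mul_add, smul_mul_assoc, mul_smul_comm,
    one_mul, mul_one]
  congr 1; congr 1; congr 1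
  all_goals
    congr 1
    simp only [mul_sub, sub_mul, ← mul_assoc, ← map_mul, hii, hjj, hkk, hij, hji, hjk, hkj,
      hki, hik, map_neg, map_one, neg_mul]
    simp only [mul_assoc, hii, hjj, hkk, hij, hji, hjk, hkj, hki, hik, mul_neg, mul_one, one_mul]
    abel

theorem exists_averagedIntertwiner_ne_zero (φ : Quaternion ℝ →ₐ[ℝ] Quaternion ℝ) :
    ∃ t, averagedIntertwiner φ t ≠ 0 := by
  by_contra! h
  have h1 := h 1
  have hi := h unitI
  have hj := h unitJ
  have hk := h unitK
  simp only [averagedIntertwiner, Quaternion.ext_iff] at h1 hi hj hk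
  simp at h1 hi hj hk
  linarith

end Quaternion

/-- Every `ℝ`-algebra automorphism of the quaternions is inner:  it is conjugation
by some unit quaternion `q`.  (Hence `Aut(ℍ) ≅ SO(3)`.) -/
theorem quaternion_automorphism_inner (φ : Quaternion ℝ ≃ₐ[ℝ] Quaternion ℝ) :
    ∃ q : Quaternion ℝ, ‖q‖ = 1 ∧ ∀ x : Quaternion ℝ, φ x = q * x * q⁻¹ := by
  obtain ⟨t, ht⟩ := Quaternion.exists_averagedIntertwiner_ne_zero φ.toAlgHom
  have hint := Quaternion.map_mul_averagedIntertwiner φ.toAlgHom t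
  generalize Quaternion.averagedIntertwiner φ.toAlgHom t = p at ht hint
  have hq : ‖p‖⁻¹ • p ≠ 0 := smul_ne_zero (inv_ne_zero (norm_ne_zero_iff.2 ht)) ht
  refine ⟨‖p‖⁻¹ • p, ?_, fun x => ?_⟩
  · rw [norm_smul, norm_inv, norm_norm, inv_mul_cancel₀ (norm_ne_zero_iff.2 ht)]
  · rw [eq_mul_inv_iff_mul_eq₀ hq, mul_smul_comm, smul_mul_assoc, ← hint x]
    rfl
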